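/- arXiv:2106.12686 — 5 statements merged into one kernel-verified Lean document; each statement's English description precedes it below -/
import Mathlib

section
/- Let n ≥ 1, let x : {1,…,n} → ℝ satisfy 0 ≤ x_a ≤ 1 for all a, let O : {1,…,n} × {1,…,n} → ℝ take values in {0,1} with ∑_{j=1}^n O_{a,j} = 1 for every a and ∑_{a=1}^n O_{a,j} = 1 for every j, and let Z : {1,…,n} → ℝ be nondecreasing and satisfy, for all a and j, Z_j ≤ x_a + 1 − O_{a,j} and Z_j ≥ x_a − 1 + O_{a,j}. Then there exists a permutation σ of {1,…,n} such that O_{a,j} = 1 if and only if a = σ(j), Z_j = x_{σ(j)} for every j, and consequently Z equals the nondecreasing rearrangement of x. -/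
theorem aux_unique {n : ℕ} (f : Fin n → ℝ) (h01 : ∀ i, f i = 0 ∨ f i = 1)
    (hs : ∑ i, f i = 1) : ∃ i, f i = 1 ∧ ∀ k, f k = 1 → k = i := by
  have hex : ∃ i, f i = 1 := by
    by_contra hc
    push Not at hc
    have : ∑ i, f i = 0 := Finset.sum_eq_zero fun i _ => (h01 i).resolve_right (hc i)
    linarith
  obtain ⟨i, hi⟩ := hex
  refine ⟨i, hi, fun k hk => ?_⟩
  by_contra hne
  have h0 : ∀ j, 0 ≤ f j := fun j => by rcases h01 j with h | h <;> rw [h] <;> norm_num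
  have h2 : ∑ j ∈ ({k, i} : Finset (Fin n)), f j ≤ ∑ j, f j :=
    Finset.sum_le_sum_of_subset_of_nonneg (Finset.subset_univ _) fun j _ _ => h0 j
  rw [Finset.sum_pair hne] at h2
  linarith

/-- Correctness of the mixed-integer encoding of ranked demand coverages:
the assignment variables `O` form a 0–1 permutation matrix, the linking
constraints tie `Z j` to the value `x a` assigned rank `j`, and monotonicity
forces `Z` to be the nondecreasing rearrangement of `x`. -/
theorem stmt0 (n : ℕ) (hn : 1 ≤ n) (x : Fin n → ℝ)
    (hx : ∀ a, 0 ≤ x a ∧ x a ≤ 1)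
    (O : Fin n → Fin n → ℝ)
    (hO01 : ∀ a j, O a j = 0 ∨ O a j = 1)
    (hrow : ∀ a, ∑ j, O a j = 1)
    (hcol : ∀ j, ∑ a, O a j = 1)
    (Z : Fin n → ℝ) (hZmono : Monotone Z)
    (hlink1 : ∀ a j, Z j ≤ x a + 1 - O a j)
    (hlink2 : ∀ a j, Z j ≥ x a - 1 + O a j) :
    ∃ σ : Equiv.Perm (Fin n),
      (∀ a j, O a j = 1 ↔ a = σ j) ∧
      (∀ j, Z j = x (σ j)) ∧
      Z = x ∘ Tuple.sort x := by
  choose s hs1 hs2 using fun j => aux_unique (fun a => O a j) (fun a => hO01 a j) (hcol j)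
  have hinj : Function.Injective s := by
    intro j k hjk
    obtain ⟨i, -, hi⟩ := aux_unique (O (s j)) (hO01 (s j)) (hrow (s j))
    have h1 : O (s j) j = 1 := hs1 j
    have h2 : O (s j) k = 1 := by rw [hjk]; exact hs1 k
    rw [hi j h1, hi k h2]
  have hZ : ∀ j, Z j = x (s j) := by
    intro j
    have h1 : O (s j) j = 1 := hs1 j
    have h2 := hlink1 (s j) j
    have h3 := hlink2 (s j) j
    linarith
  let σ : Equiv.Perm (Fin n) := Equiv.ofBijective s (Finite.injective_iff_bijective.mp hinj)
  have hZ' : Z = x ∘ σ := funext hZ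
  refine ⟨σ, fun a j => ⟨fun h => hs2 j a h, fun h => ?_⟩, hZ, ?_⟩
  · rw [h]; exact hs1 j
  · rw [hZ']
    exact (Tuple.comp_sort_eq_comp_iff_monotone.mpr (hZ' ▸ hZmono))
end

section
/- Let n ≥ 1 and let Z : {1,…,n} → ℝ be nondecreasing. Then ∑_{j=1}^n (2n + 1 − 2j) Z_j ≤ n·(∑_{j=1}^n Z_j) + (n − 1)·(Z_1 − Z_n); equivalently ∑_{j=1}^n (n + 1 − 2j) Z_j ≤ (n − 1)(Z_1 − Z_n). Consequently, in the optimization model, setting H^L equal to the minimum and H^U equal to the maximum of the demand coverages satisfies the valid inequality ∑_j (2n+1−2j)Z_j ≤ nU + (n−1)(H^L − H^U), so the inequality cuts off no feasible allocation. -/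
theorem stmt9_aux (Z : ℕ → ℝ) (n : ℕ) (hn : 1 ≤ n) (hmono : MonotoneOn Z (Set.Icc 1 n)) :
    (∑ j ∈ Finset.Icc 1 n, Z j ≤ Z 1 + ((n:ℝ) - 1) * Z n) ∧
    (∑ j ∈ Finset.Icc 1 n, ((n:ℝ) + 1 - 2 * (j:ℝ)) * Z j
        ≤ ((n:ℝ) - 1) * (Z 1 - Z n)) := by
  induction n, hn using Nat.le_induction with
  | base => norm_num
  | succ n hn ih =>
    obtain ⟨h1, h2⟩ := ih (hmono.mono (Set.Icc_subset_Icc_right (Nat.le_succ n)))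
    have h3 : Z n ≤ Z (n + 1) :=
      hmono ⟨hn, Nat.le_succ n⟩ ⟨by omega, le_refl _⟩ (Nat.le_succ n)
    have hn' : (1:ℝ) ≤ n := by exact_mod_cast hn
    have h4 : ((n:ℝ) - 1) * Z n ≤ ((n:ℝ) - 1) * Z (n + 1) :=
      mul_le_mul_of_nonneg_left h3 (by linarith)
    have h5 : ∑ j ∈ Finset.Icc 1 n, (((n + 1 : ℕ) : ℝ) + 1 - 2 * (j:ℝ)) * Z j
        = ∑ j ∈ Finset.Icc 1 n, ((n:ℝ) + 1 - 2 * (j:ℝ)) * Z j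
          + ∑ j ∈ Finset.Icc 1 n, Z j := by
      rw [← Finset.sum_add_distrib]
      refine Finset.sum_congr rfl fun j _ => ?_
      push_cast
      ring
    rw [Finset.sum_Icc_succ_top (by omega), Finset.sum_Icc_succ_top (by omega), h5]
    push_cast
    constructor <;> nlinarith

/-- Validity of the upper-bounding-Lorenz-curve inequality: for nondecreasing
`Z`, `∑_j (2n+1−2j) Z j ≤ n·(∑_j Z j) + (n−1)·(Z 1 − Z n)`, equivalently
`∑_j (n+1−2j) Z j ≤ (n−1)(Z 1 − Z n)`; hence with `H^L` the minimum and `H^U`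
the maximum demand coverage the valid inequality cuts off no feasible point. -/
theorem stmt9 (n : ℕ) (hn : 1 ≤ n) (Z : ℕ → ℝ)
    (hmono : MonotoneOn Z (Set.Icc 1 n)) :
    (∑ j ∈ Finset.Icc 1 n, (2 * (n:ℝ) + 1 - 2 * (j:ℝ)) * Z j
        ≤ (n:ℝ) * (∑ j ∈ Finset.Icc 1 n, Z j) + ((n:ℝ) - 1) * (Z 1 - Z n)) ∧
    (∑ j ∈ Finset.Icc 1 n, ((n:ℝ) + 1 - 2 * (j:ℝ)) * Z j
        ≤ ((n:ℝ) - 1) * (Z 1 - Z n)) := by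
  have h := (stmt9_aux Z n hn hmono).2
  refine ⟨?_, h⟩
  have h5 : ∑ j ∈ Finset.Icc 1 n, (2 * (n:ℝ) + 1 - 2 * (j:ℝ)) * Z j
      = (n:ℝ) * (∑ j ∈ Finset.Icc 1 n, Z j)
        + ∑ j ∈ Finset.Icc 1 n, ((n:ℝ) + 1 - 2 * (j:ℝ)) * Z j := by
    rw [Finset.mul_sum, ← Finset.sum_add_distrib]
    exact Finset.sum_congr rfl fun j _ => by ring
  linarith
end

section
/- Let n ≥ 3 and let Z : {1,…,n} → ℝ be nondecreasing with total U := ∑_{j=1}^n Z_j and partial sums S_k := ∑_{j=1}^k Z_j. Then for every 1 ≤ k ≤ n − 1, S_k ≤ Z_1 + ((k − 1)/(n − 2))·(U − Z_1 − Z_n). In other words, at every knot percentile k/n with 1 ≤ k ≤ n−1, the Lorenz curve of Z lies below the affine curve through the points (1/n, Z_1/U) and ((n−1)/n, (U − Z_n)/U). -/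
/-- The true Lorenz curve lies below the upper-bounding Lorenz curve at every
knot: for nondecreasing `Z` with total `U` and partial sums `S`, for every
`1 ≤ k ≤ n − 1`, `S k ≤ Z 1 + ((k − 1)/(n − 2))·(U − Z 1 − Z n)`. -/
theorem stmt10 (n : ℕ) (hn : 3 ≤ n) (Z : ℕ → ℝ)
    (hmono : MonotoneOn Z (Set.Icc 1 n))
    (U : ℝ) (hU : U = ∑ j ∈ Finset.Icc 1 n, Z j)
    (S : ℕ → ℝ) (hS : ∀ k, S k = ∑ j ∈ Finset.Icc 1 k, Z j) :
    ∀ k, 1 ≤ k → k ≤ n - 1 →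
      S k ≤ Z 1 + (((k:ℝ) - 1) / ((n:ℝ) - 2)) * (U - Z 1 - Z n) := by
  intro k hk hkn
  have hstep : ∀ m, S (m + 1) = S m + Z (m + 1) := by
    intro m
    rw [hS, hS, Finset.sum_Icc_succ_top (by omega)]
  have h1 : S 1 = Z 1 := by simp [hS]
  have up : ∀ j, 1 ≤ j → j ≤ k → S j - Z 1 ≤ ((j:ℝ) - 1) * Z k := by
    intro j hj
    induction j, hj using Nat.le_induction with
    | base => intro _; simp [h1]
    | succ m hm ih =>
      intro h
      have a := ih (by omega)
      have b : Z (m + 1) ≤ Z k := hmono ⟨by omega, by omega⟩ ⟨by omega, by omega⟩ h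
      rw [hstep]
      push_cast
      linarith
  have lo : ∀ m, k ≤ m → m ≤ n → ((m:ℝ) - k) * Z k ≤ S m - S k := by
    intro m hm
    induction m, hm using Nat.le_induction with
    | base => intro _; simp
    | succ m hm ih =>
      intro h
      have a := ih (by omega)
      have b : Z k ≤ Z (m + 1) := hmono ⟨by omega, by omega⟩ ⟨by omega, by omega⟩ (by omega)
      rw [hstep]
      push_cast
      linarith
  obtain ⟨p, rfl⟩ : ∃ p, n = p + 1 := ⟨n - 1, by omega⟩
  have hkp : k ≤ p := by omega
  have hUS : U = S p + Z (p + 1) := by rw [hU, ← hS, hstep]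
  have a := up k hk le_rfl
  have b := lo p hkp (by omega)
  have c1 : (0:ℝ) ≤ (k:ℝ) - 1 := by
    have : (1:ℝ) ≤ k := by exact_mod_cast hk
    linarith
  have c2 : (0:ℝ) ≤ (p:ℝ) - k := by
    have : (k:ℝ) ≤ p := by exact_mod_cast hkp
    linarith
  have c3 : (0:ℝ) < ((p + 1 : ℕ):ℝ) - 2 := by
    have : (3:ℝ) ≤ ((p + 1 : ℕ):ℝ) := by exact_mod_cast hn
    linarith
  have d1 := mul_le_mul_of_nonneg_left a c2
  have d2 := mul_le_mul_of_nonneg_left b c1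
  have key : S k - Z 1 ≤ (((k:ℝ) - 1) / (((p + 1 : ℕ):ℝ) - 2)) * (U - Z 1 - Z (p + 1)) := by
    rw [div_mul_eq_mul_div, le_div_iff₀ c3, hUS]
    push_cast
    linarith
  linarith
end

section
/- Let n ≥ 1 and let Z : {1,…,n} → ℝ be nondecreasing with Z_j ≥ 0 and U := ∑_{j=1}^n Z_j > 0. Let 1 ≤ i < k ≤ n and ε > 0, and define Z' by Z'_i = Z_i + ε, Z'_k = Z_k − ε, and Z'_j = Z_j for j ∉ {i,k}. If Z' is still nondecreasing, then ∑_j Z'_j = U and the trapezoid Gini coefficient strictly decreases: (1/(nU)) ∑_{j=1}^n (2j − n − 1) Z'_j < (1/(nU)) ∑_{j=1}^n (2j − n − 1) Z_j. -/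
/-- Pigou–Dalton Principle of Transfers for the trapezoid Gini coefficient:
a rank-preserving transfer of `ε > 0` from a richer entry `k` to a poorer
entry `i < k` preserves the total and strictly decreases the coefficient. -/
theorem stmt12 (n : ℕ) (hn : 1 ≤ n) (Z Z' : ℕ → ℝ)
    (hmono : MonotoneOn Z (Set.Icc 1 n))
    (hpos : ∀ j ∈ Finset.Icc 1 n, 0 ≤ Z j)
    (U : ℝ) (hU : U = ∑ j ∈ Finset.Icc 1 n, Z j) (hUpos : 0 < U)
    (i k : ℕ) (hi : 1 ≤ i) (hik : i < k) (hk : k ≤ n)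
    (ε : ℝ) (hε : 0 < ε)
    (hZ'i : Z' i = Z i + ε) (hZ'k : Z' k = Z k - ε)
    (hZ'j : ∀ j, j ≠ i → j ≠ k → Z' j = Z j)
    (hmono' : MonotoneOn Z' (Set.Icc 1 n)) :
    (∑ j ∈ Finset.Icc 1 n, Z' j = U) ∧
    (1 / (n * U)) * ∑ j ∈ Finset.Icc 1 n, (2 * (j:ℝ) - n - 1) * Z' j
      < (1 / (n * U)) * ∑ j ∈ Finset.Icc 1 n, (2 * (j:ℝ) - n - 1) * Z j := by
  have key : ∀ c : ℕ → ℝ, ∑ j ∈ Finset.Icc 1 n, c j * Z' j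
      = ∑ j ∈ Finset.Icc 1 n, c j * Z j + (c i - c k) * ε := by
    intro c
    have h : ∀ j ∈ Finset.Icc 1 n, c j * Z' j
        = c j * Z j + ((if j = i then c i * ε else 0) - (if j = k then c k * ε else 0)) := by
      intro j _
      by_cases h1 : j = i
      · subst h1
        rw [if_pos rfl, if_neg hik.ne, hZ'i]; ring
      · by_cases h2 : j = k
        · subst h2
          rw [if_neg h1, if_pos rfl, hZ'k]; ring
        · rw [if_neg h1, if_neg h2, hZ'j j h1 h2]; ring
    have mi : i ∈ Finset.Icc 1 n := Finset.mem_Icc.2 ⟨hi, by omega⟩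
    have mk : k ∈ Finset.Icc 1 n := Finset.mem_Icc.2 ⟨by omega, hk⟩
    rw [Finset.sum_congr rfl h, Finset.sum_add_distrib, Finset.sum_sub_distrib,
      Finset.sum_ite_eq', Finset.sum_ite_eq', if_pos mi, if_pos mk]
    ring
  constructor
  · have := key (fun _ => 1)
    simp only [one_mul, sub_self, zero_mul, add_zero] at this
    rw [this, hU]
  · have hn' : (0:ℝ) < n := by exact_mod_cast hn
    have hik' : (i:ℝ) < k := by exact_mod_cast hik
    apply mul_lt_mul_of_pos_left _ (by positivity)
    rw [key (fun j => 2 * (j:ℝ) - n - 1)]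
    nlinarith [mul_pos (sub_pos.2 hik') hε]
end

section
/- Let n ≥ 1 and let x : {1,…,n} → ℝ be a sequence of nonnegative reals with U := ∑_{i=1}^n x_i > 0, and let Z : {1,…,n} → ℝ be its nondecreasing rearrangement. Then the Gini mean difference measure equals the trapezoid Gini coefficient: (∑_{i=1}^n ∑_{j=1}^n |x_i − x_j|)/(2 n² x̄) = (1/(nU)) ∑_{j=1}^n (2j − n − 1) Z_j, where x̄ := U/n. -/
theorem gini_aux (n : ℕ) : ∀ (Z : Fin n → ℝ), Monotone Z →
    (∑ i : Fin n, ∑ j : Fin n, |Z i - Z j|)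
      = 2 * ∑ j : Fin n, (2 * ((j:ℕ) + 1 : ℝ) - n - 1) * Z j := by
  induction n with
  | zero => intro Z _; simp
  | succ n ih =>
    intro Z hZ
    have h := ih (fun i => Z i.castSucc) (fun a b hab => hZ (by simpa using hab))
    have h1 : ∀ i : Fin n, |Z i.castSucc - Z (Fin.last n)| = Z (Fin.last n) - Z i.castSucc := by
      intro i
      rw [abs_sub_comm, abs_of_nonneg (sub_nonneg.2 (hZ (Fin.le_last _)))]
    have h2 : ∀ i : Fin n, |Z (Fin.last n) - Z i.castSucc| = Z (Fin.last n) - Z i.castSucc := by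
      intro i
      rw [abs_of_nonneg (sub_nonneg.2 (hZ (Fin.le_last _)))]
    have h3 : ∑ j : Fin n, (2 * ((j:ℕ) + 1 : ℝ) - (n + 1) - 1) * Z j.castSucc
        = ∑ j : Fin n, (2 * ((j:ℕ) + 1 : ℝ) - n - 1) * Z j.castSucc
          - ∑ j : Fin n, Z j.castSucc := by
      rw [← Finset.sum_sub_distrib]
      exact Finset.sum_congr rfl fun j _ => by ring
    simp only [Fin.sum_univ_castSucc, Finset.sum_add_distrib, h1, h2, h, Fin.val_castSucc,
      Fin.val_last, Nat.cast_add, Nat.cast_one, h3, Finset.sum_sub_distrib, Finset.sum_const,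
      Finset.card_univ, Fintype.card_fin, nsmul_eq_mul, sub_self, abs_zero]
    ring

/-- The Gini mean difference measure coincides with the trapezoid Gini
coefficient: for nonnegative `x` with total `U > 0`, mean `x̄ = U/n`, and `Z`
the nondecreasing rearrangement of `x`,
`(∑_i ∑_j |x i − x j|)/(2n²x̄) = (1/(nU)) ∑_{j=1}^n (2j − n − 1) Z j`. -/
theorem stmt15 (n : ℕ) (hn : 1 ≤ n) (x : Fin n → ℝ)
    (hx : ∀ i, 0 ≤ x i)
    (U : ℝ) (hU : U = ∑ i : Fin n, x i) (hUpos : 0 < U)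
    (xbar : ℝ) (hxbar : xbar = U / n)
    (Z : Fin n → ℝ) (hZ : Z = x ∘ Tuple.sort x) :
    (∑ i : Fin n, ∑ j : Fin n, |x i - x j|) / (2 * (n:ℝ)^2 * xbar)
      = (1 / (n * U)) * ∑ j : Fin n, (2 * ((j:ℕ) + 1 : ℝ) - n - 1) * Z j := by
  have hm : Monotone Z := by rw [hZ]; exact Tuple.monotone_sort x
  have hs : (∑ i : Fin n, ∑ j : Fin n, |x i - x j|) = ∑ i : Fin n, ∑ j : Fin n, |Z i - Z j| := by
    rw [hZ, ← Equiv.sum_comp (Tuple.sort x)]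
    refine Finset.sum_congr rfl fun i _ => ?_
    rw [← Equiv.sum_comp (Tuple.sort x)]
    rfl
  rw [hs, gini_aux n Z hm, hxbar]
  have hn0 : (n:ℝ) ≠ 0 := by positivity
  have hU0 : U ≠ 0 := hUpos.ne'
  field_simp
end
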